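/- Weierstrass intertwining of representations: Let ℘(z) := 1/z² + Σ_{γ∈Λ∖{0}} (1/(z−γ)² − 1/γ²) be the Weierstrass ℘-function of the lattice Λ = ℤω + ℤ. Let U be a tunnelling potential, consider the chiral model D(α), and assume dim_ℂ Ker_p(α) ≤ 1 for every p ∈ {0,1,2}. Then multiplication by ℘ maps Ker₁(α) bijectively onto Ker₀(α): for every u ∈ Ker₁(α) the function z ↦ ℘(z)·u(z) (defined on ℂ∖Λ) extends to a smooth function on ℂ which belongs to Ker₀(α) (the extension exists because u vanishes to second order on Λ), and {extension of ℘·u : u ∈ Ker₁(α)} = Ker₀(α). -/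

import Mathlib

noncomputable section

open Complex MeasureTheory

namespace TBG

/-- `ω = exp(2πi/3)`. -/
def ω : ℂ := Complex.exp (2 * Real.pi * Complex.I / 3)

/-- The moiré lattice `Λ = ℤω + ℤ ⊂ ℂ`. -/
def Λ : Set ℂ := {z : ℂ | ∃ m n : ℤ, z = m * ω + n}

/-- The dual lattice `Λ* = (4πi/√3)·Λ`. -/
def Λdual : Set ℂ := {p : ℂ | ∃ m n : ℤ, p = 4 * Real.pi * Complex.I / Real.sqrt 3 * (m * ω + n)}

/-- The high symmetry point `K = 4π/3`. -/
def K : ℂ := 4 * Real.pi / 3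

/-- `⟨z,w⟩ = Re (z · conj w)`. -/
def pair (z w : ℂ) : ℝ := (z * (starRingEnd ℂ) w).re

/-- `2 D_z̄ f = (1/i)(∂_x f + i ∂_y f)`. -/
def Dbar (f : ℂ → ℂ) (z : ℂ) : ℂ :=
  1 / Complex.I * (fderiv ℝ f z 1 + Complex.I * fderiv ℝ f z Complex.I)

/-- A tunnelling potential: smooth, with the translational and rotational symmetries. -/
def IsTunnelling (U : ℂ → ℂ) : Prop :=
  ContDiff ℝ (⊤ : ℕ∞) U ∧
    (∀ γ ∈ Λ, ∀ z : ℂ, U (z + γ) = Complex.exp (Complex.I * (pair γ K : ℂ)) * U z) ∧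
    ∀ z : ℂ, U (ω * z) = ω * U z

/-- Membership in `ker_{L²₀}(D(α)+k)` for the chiral model with tunnelling
potentials `U₊ = Up`, `U₋ = Um`: smooth solutions of `(D(α)+k)u = 0` with the
Floquet boundary conditions. -/
def InKer (Up Um : ℂ → ℂ) (α k : ℂ) (u : ℂ → ℂ × ℂ) : Prop :=
  ContDiff ℝ (⊤ : ℕ∞) u ∧
    (∀ z : ℂ, Dbar (fun w => (u w).1) z + k * (u z).1 + α * Up z * (u z).2 = 0) ∧
    (∀ z : ℂ, Dbar (fun w => (u w).2) z + k * (u z).2 + α * Um z * (u z).1 = 0) ∧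
    (∀ γ ∈ Λ, ∀ z : ℂ, (u (z + γ)).1 = Complex.exp (-Complex.I * (pair γ K : ℂ)) * (u z).1) ∧
    (∀ γ ∈ Λ, ∀ z : ℂ, (u (z + γ)).2 = Complex.exp (Complex.I * (pair γ K : ℂ)) * (u z).2)

/-- `Ker(α,k)` as a set of functions. -/
def kerSet (Up Um : ℂ → ℂ) (α k : ℂ) : Set (ℂ → ℂ × ℂ) := {u | InKer Up Um α k u}

/-- `dim_ℂ Ker(α,k)` (the set `Ker(α,k)` is a linear subspace, so the finrank of its span
is its dimension). -/
def kerDim (Up Um : ℂ → ℂ) (α k : ℂ) : ℕ :=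
  Module.finrank ℂ ↥(Submodule.span ℂ (kerSet Up Um α k))

/-- `Ker_p(α) = {u ∈ Ker(α,0) : u(ωz) = ω^(−p)·u(z)}`. -/
def kerPSet (Up Um : ℂ → ℂ) (α : ℂ) (p : ℕ) : Set (ℂ → ℂ × ℂ) :=
  {u | u ∈ kerSet Up Um α 0 ∧ ∀ z : ℂ, u (ω * z) = (ω ^ (-(p : ℤ))) • u z}

/-- `dim_ℂ Ker_p(α)`. -/
def kerPDim (Up Um : ℂ → ℂ) (α : ℂ) (p : ℕ) : ℕ :=
  Module.finrank ℂ ↥(Submodule.span ℂ (kerPSet Up Um α p))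

/-- `α` is magic: the flat band condition `Ker(α,k) ≠ {0}` for every `k`. -/
def IsMagic (Up Um : ℂ → ℂ) (α : ℂ) : Prop :=
  ∀ k : ℂ, ∃ u ∈ kerSet Up Um α k, u ≠ 0


/-- The Weierstrass `℘`-function of the lattice `Λ`:
`℘(z) = 1/z² + Σ_{γ∈Λ∖{0}} (1/(z−γ)² − 1/γ²)`. -/
def wp (z : ℂ) : ℂ :=
  1 / z ^ 2 + ∑' γ : {g : ℂ // g ∈ Λ ∧ g ≠ 0}, (1 / (z - (γ : ℂ)) ^ 2 - 1 / (γ : ℂ) ^ 2)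

open Filter Topology Set

section Hadamard

variable {H E : Type} [NormedAddCommGroup H] [NormedSpace ℝ H]
  [NormedAddCommGroup E] [NormedSpace ℝ E]

lemma hasFDerivAt_integral_param [ProperSpace H] (G : H × ℝ → E) (hG : ContDiff ℝ 1 G) (x : H) :
    HasFDerivAt (fun x => ∫ t in (0 : ℝ)..1, G (x, t))
      (∫ t in (0 : ℝ)..1, (fderiv ℝ G (x, t)).comp (ContinuousLinearMap.inl ℝ H ℝ)) x := by
  have hc : Continuous
      (fun q : H × ℝ => (fderiv ℝ G q).comp (ContinuousLinearMap.inl ℝ H ℝ)) :=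
    (hG.continuous_fderiv one_ne_zero).clm_comp continuous_const
  obtain ⟨C, hC⟩ := ((isCompact_closedBall x 1).prod
    (isCompact_Icc (a := (0 : ℝ)) (b := 1))).exists_bound_of_continuousOn hc.continuousOn
  refine intervalIntegral.hasFDerivAt_integral_of_dominated_of_fderiv_le
    (F := fun x t => G (x, t))
    (F' := fun x t => (fderiv ℝ G (x, t)).comp (ContinuousLinearMap.inl ℝ H ℝ))
    (bound := fun _ => C) (Metric.closedBall_mem_nhds x one_pos) ?_ ?_ ?_ ?_ ?_ ?_
  · exact Eventually.of_forall fun y =>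
      (hG.continuous.comp (Continuous.prodMk_right y)).aestronglyMeasurable
  · exact (hG.continuous.comp (Continuous.prodMk_right x)).intervalIntegrable _ _
  · exact (hc.comp (Continuous.prodMk_right x)).aestronglyMeasurable
  · refine Eventually.of_forall fun t ht y hy => hC (y, t) ⟨hy, ?_⟩
    rw [uIoc_of_le zero_le_one] at ht
    exact Ioc_subset_Icc_self ht
  · exact intervalIntegrable_const
  · refine Eventually.of_forall fun t _ y _ => ?_
    exact ((hG.differentiable one_ne_zero (y, t)).hasFDerivAt).comp y (hasFDerivAt_prodMk_left y t)

end Hadamard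

lemma contDiff_integral_param_nat {H : Type} [NormedAddCommGroup H] [NormedSpace ℝ H]
    [ProperSpace H] (n : ℕ) : ∀ {E : Type} [NormedAddCommGroup E] [NormedSpace ℝ E]
    (G : H × ℝ → E), ContDiff ℝ (⊤ : ℕ∞) G →
      ContDiff ℝ n (fun x => ∫ t in (0 : ℝ)..1, G (x, t)) := by
  induction n with
  | zero =>
    intro E _ _ G hG
    rw [Nat.cast_zero, contDiff_zero]
    exact continuous_iff_continuousAt.2 fun x =>
      (hasFDerivAt_integral_param G (hG.of_le (by exact_mod_cast le_top)) x).continuousAt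
  | succ n ih =>
    intro E _ _ G hG
    have hd := hasFDerivAt_integral_param G (hG.of_le (by exact_mod_cast le_top))
    rw [Nat.cast_add, Nat.cast_one, contDiff_succ_iff_fderiv]
    refine ⟨fun x => (hd x).differentiableAt, by simp, ?_⟩
    rw [funext fun x => (hd x).fderiv]
    exact ih (fun q => (fderiv ℝ G q).comp (ContinuousLinearMap.inl ℝ H ℝ))
      ((hG.fderiv_right (by simp)).clm_comp contDiff_const)

lemma contDiff_integral_param {H : Type} [NormedAddCommGroup H] [NormedSpace ℝ H]
    [ProperSpace H] {E : Type} [NormedAddCommGroup E] [NormedSpace ℝ E]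
    (G : H × ℝ → E) (hG : ContDiff ℝ (⊤ : ℕ∞) G) :
    ContDiff ℝ (⊤ : ℕ∞) (fun x => ∫ t in (0 : ℝ)..1, G (x, t)) :=
  contDiff_infty.2 fun n => contDiff_integral_param_nat n G hG

/-- Hadamard's lemma in the complex coordinates `z`, `conj z`. -/
lemma exists_eq_mul_add_conj_mul {f : ℂ → ℂ} (hf : ContDiff ℝ (⊤ : ℕ∞) f) (h0 : f 0 = 0) :
    ∃ A B : ℂ → ℂ, ContDiff ℝ (⊤ : ℕ∞) A ∧ ContDiff ℝ (⊤ : ℕ∞) B ∧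
      ∀ z, f z = z * A z + (starRingEnd ℂ) z * B z := by
  have hf' : ContDiff ℝ (⊤ : ℕ∞) (fun q : ℂ × ℝ => fderiv ℝ f (q.2 • q.1)) :=
    (hf.fderiv_right (by simp)).comp (contDiff_snd.smul contDiff_fst)
  have key : ∀ v : ℂ, ContDiff ℝ (⊤ : ℕ∞) (fun z => ∫ t in (0 : ℝ)..1, fderiv ℝ f (t • z) v) :=
    fun v => contDiff_integral_param (fun q : ℂ × ℝ => fderiv ℝ f (q.2 • q.1) v)
      (hf'.clm_apply contDiff_const)
  have hint : ∀ z : ℂ, f z = ∫ t in (0 : ℝ)..1, fderiv ℝ f (t • z) z := by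
    intro z
    have hd : ∀ t : ℝ, HasDerivAt (fun t : ℝ => f (t • z)) (fderiv ℝ f (t • z) z) t := by
      intro t
      have h1 : HasDerivAt (fun t : ℝ => t • z) z t := by
        simpa using (hasDerivAt_id t).smul_const z
      exact ((hf.differentiable (by simp)) (t • z)).hasFDerivAt.comp_hasDerivAt t h1
    have hcont : Continuous fun t : ℝ => fderiv ℝ f (t • z) z :=
      ((hf.continuous_fderiv (by simp)).comp (by fun_prop)).clm_apply continuous_const
    rw [intervalIntegral.integral_eq_sub_of_hasDerivAt (fun t _ => hd t)
      (hcont.intervalIntegrable _ _)]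
    simp [h0]
  have hcont : ∀ z v : ℂ, Continuous fun t : ℝ => fderiv ℝ f (t • z) v := fun z v =>
    ((hf.continuous_fderiv (by simp)).comp (by fun_prop)).clm_apply continuous_const
  refine ⟨fun z => 1 / 2 * ((∫ t in (0 : ℝ)..1, fderiv ℝ f (t • z) 1)
      - I * ∫ t in (0 : ℝ)..1, fderiv ℝ f (t • z) I),
    fun z => 1 / 2 * ((∫ t in (0 : ℝ)..1, fderiv ℝ f (t • z) 1)
      + I * ∫ t in (0 : ℝ)..1, fderiv ℝ f (t • z) I),
    contDiff_const.mul ((key 1).sub (contDiff_const.mul (key I))),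
    contDiff_const.mul ((key 1).add (contDiff_const.mul (key I))), fun z => ?_⟩
  have hsplit : ∀ t : ℝ, fderiv ℝ f (t • z) z
      = (z.re : ℂ) * fderiv ℝ f (t • z) 1 + (z.im : ℂ) * fderiv ℝ f (t • z) I := by
    intro t
    have : z = z.re • (1 : ℂ) + z.im • I := by simp
    conv_lhs => rw [this]
    rw [map_add, map_smul, map_smul, ← this]
    simp
  rw [hint z, intervalIntegral.integral_congr (fun t _ => hsplit t),
    intervalIntegral.integral_add (((hcont z 1).const_mul _).intervalIntegrable _ _)
      (((hcont z I).const_mul _).intervalIntegrable _ _),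
    intervalIntegral.integral_const_mul, intervalIntegral.integral_const_mul]
  have hz := re_add_im z
  have hz' : (starRingEnd ℂ) z = z.re - z.im * I := by
    apply Complex.ext <;> simp
  beta_reduce
  rw [hz']
  generalize (∫ t in (0 : ℝ)..1, fderiv ℝ f (t • z) 1) = P
  generalize (∫ t in (0 : ℝ)..1, fderiv ℝ f (t • z) I) = Q
  linear_combination (1 / 2 * (P - I * Q)) * hz + ((z.im : ℂ) * Q) * I_sq

/-- `conj z ^ n / z ^ m` is `k` times continuously differentiable when `n > m + k`. -/
lemma contDiff_conj_pow_div_pow (k : ℕ) : ∀ n m : ℕ, m + k < n →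
    ContDiff ℝ k (fun z : ℂ => (starRingEnd ℂ) z ^ n / z ^ m) := by
  have hcont : ∀ n m : ℕ, m < n → Continuous (fun z : ℂ => (starRingEnd ℂ) z ^ n / z ^ m) := by
    intro n m hnm
    refine continuous_iff_continuousAt.2 fun z => ?_
    by_cases hz : z = 0
    · subst hz
      have h0 : n ≠ 0 := by omega
      rw [ContinuousAt, map_zero, zero_pow h0, zero_div]
      refine squeeze_zero_norm (a := fun w : ℂ => ‖w‖ ^ (n - m)) (fun w => ?_) ?_
      · rw [norm_div, norm_pow, norm_pow, RCLike.norm_conj]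
        by_cases hw : w = 0
        · subst hw; simp [h0]
        · rw [div_le_iff₀ (by positivity), ← pow_add, Nat.sub_add_cancel hnm.le]
      · have : Tendsto (fun w : ℂ => ‖w‖ ^ (n - m)) (𝓝 0) (𝓝 (‖(0 : ℂ)‖ ^ (n - m))) :=
          (by fun_prop : Continuous fun w : ℂ => ‖w‖ ^ (n - m)).tendsto 0
        simpa [Nat.sub_ne_zero_of_lt hnm] using this
    · exact (by fun_prop : Continuous fun z : ℂ => (starRingEnd ℂ) z ^ n).continuousAt.div
        (by fun_prop) (pow_ne_zero _ hz)
  induction k with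
  | zero =>
    intro n m hnm
    rw [Nat.cast_zero, contDiff_zero]
    exact hcont n m hnm
  | succ k ih =>
    intro n m hnm
    have hd : ∀ z : ℂ, HasFDerivAt (fun z : ℂ => (starRingEnd ℂ) z ^ n / z ^ m)
        (((n : ℂ) * ((starRingEnd ℂ) z ^ (n - 1) / z ^ m)) • (conjCLE : ℂ →L[ℝ] ℂ)
          - ((m : ℂ) * ((starRingEnd ℂ) z ^ n / z ^ (m + 1))) • ContinuousLinearMap.id ℝ ℂ) z := by
      intro z
      by_cases hz : z = 0
      · subst hz
        have h0 : n ≠ 0 := by omega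
        have h1 : n - 1 ≠ 0 := by omega
        refine HasFDerivAt.congr_fderiv (f' := 0) ?_ (by ext; simp [h0, h1])
        rw [hasFDerivAt_iff_isLittleO_nhds_zero]
        simp only [map_zero, zero_pow h0, zero_div, sub_zero, zero_add, zero_apply]
        have h2 : (fun z : ℂ => (starRingEnd ℂ) z ^ n / z ^ m)
            = fun z : ℂ => ((starRingEnd ℂ) z ^ n / z ^ (m + 1)) * z := by
          funext z
          by_cases hz : z = 0
          · subst hz; simp [h0]
          · rw [pow_succ, ← div_div, div_mul_cancel₀ _ hz]
        rw [h2]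
        have h3 : (fun z : ℂ => (starRingEnd ℂ) z ^ n / z ^ (m + 1))
            =o[𝓝 0] fun _ => (1 : ℂ) := by
          rw [Asymptotics.isLittleO_one_iff]
          simpa [h0] using (hcont n (m + 1) (by omega)).tendsto 0
        simpa using h3.mul_isBigO (Asymptotics.isBigO_refl (fun z : ℂ => z) (𝓝 0))
      · have hc : HasFDerivAt (fun z : ℂ => (starRingEnd ℂ) z) (conjCLE : ℂ →L[ℝ] ℂ) z :=
          conjCLE.hasFDerivAt
        have h3 := ((hasDerivAt_pow m z).fun_inv (pow_ne_zero m hz)).hasFDerivAt.restrictScalars ℝ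
        refine ((hc.pow n).mul h3).congr_fderiv ?_
        ext v
        have h4 : (m : ℂ) * z ^ (m - 1) / (z ^ m) ^ 2 = m / z ^ (m + 1) := by
          cases m with
          | zero => simp
          | succ m =>
            rw [Nat.add_sub_cancel]
            field_simp
            ring
        simp only [neg_div, h4, add_apply, smul_apply, smul_eq_mul, sub_apply, nsmul_eq_mul,
          ContinuousLinearMap.coe_restrictScalars', ContinuousLinearMap.toSpanSingleton_apply,
          ContinuousLinearEquiv.coe_coe, conjCLE_apply, ContinuousLinearMap.id_apply]
        ring
    rw [Nat.cast_add, Nat.cast_one, contDiff_succ_iff_fderiv]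
    refine ⟨fun x => (hd x).differentiableAt, by simp, ?_⟩
    rw [funext fun x => (hd x).fderiv]
    exact ((contDiff_const.mul (ih _ _ (by omega))).smul contDiff_const).sub
      ((contDiff_const.mul (ih _ _ (by omega))).smul contDiff_const)

section Dbar

lemma Dbar_mul {f g : ℂ → ℂ} {z : ℂ} (hf : DifferentiableAt ℝ f z)
    (hg : DifferentiableAt ℝ g z) :
    Dbar (fun w => f w * g w) z = f z * Dbar g z + g z * Dbar f z := by
  unfold Dbar
  rw [fderiv_fun_mul hf hg]
  simp only [add_apply, smul_apply, smul_eq_mul]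
  ring

lemma Dbar_add {f g : ℂ → ℂ} {z : ℂ} (hf : DifferentiableAt ℝ f z)
    (hg : DifferentiableAt ℝ g z) :
    Dbar (fun w => f w + g w) z = Dbar f z + Dbar g z := by
  unfold Dbar
  rw [fderiv_fun_add hf hg]
  simp only [add_apply]
  ring

lemma Dbar_eq_zero_of_differentiableAt {g : ℂ → ℂ} {z : ℂ} (hg : DifferentiableAt ℂ g z) :
    Dbar g z = 0 := by
  unfold Dbar
  rw [hg.fderiv_restrictScalars ℝ]
  have h : fderiv ℂ g z I = I * fderiv ℂ g z 1 := by
    rw [← smul_eq_mul, ← map_smul, smul_eq_mul, mul_one]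
  simp only [ContinuousLinearMap.coe_restrictScalars', h]
  linear_combination (1 / I * fderiv ℂ g z 1) * I_mul_I

lemma Dbar_mul_of_differentiableAt {f g : ℂ → ℂ} {z : ℂ} (hg : DifferentiableAt ℂ g z)
    (hf : DifferentiableAt ℝ f z) :
    Dbar (fun w => g w * f w) z = g z * Dbar f z := by
  rw [Dbar_mul (hg.restrictScalars ℝ) hf, Dbar_eq_zero_of_differentiableAt hg, mul_zero, add_zero]

lemma Dbar_conj (z : ℂ) : Dbar (fun w => (starRingEnd ℂ) w) z = 2 / I := by
  unfold Dbar
  have : HasFDerivAt (fun z : ℂ => (starRingEnd ℂ) z) (conjCLE : ℂ →L[ℝ] ℂ) z :=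
    conjCLE.hasFDerivAt
  rw [this.fderiv]
  simp only [ContinuousLinearEquiv.coe_coe, conjCLE_apply, map_one, conj_I]
  linear_combination (-1 / I) * I_mul_I

lemma Dbar_congr {f g : ℂ → ℂ} {z : ℂ} (h : f =ᶠ[𝓝 z] g) : Dbar f z = Dbar g z := by
  unfold Dbar
  rw [h.fderiv_eq]

lemma Dbar_comp_add (f : ℂ → ℂ) (p z : ℂ) : Dbar (fun w => f (w + p)) z = Dbar f (z + p) := by
  unfold Dbar
  rw [fderiv_comp_add_right]

lemma contDiff_Dbar {f : ℂ → ℂ} (hf : ContDiff ℝ (⊤ : ℕ∞) f) :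
    ContDiff ℝ (⊤ : ℕ∞) (Dbar f) := by
  have h : ContDiff ℝ (⊤ : ℕ∞) (fderiv ℝ f) := hf.fderiv_right (by simp)
  exact contDiff_const.mul ((h.clm_apply contDiff_const).add
    (contDiff_const.mul (h.clm_apply contDiff_const)))

lemma contDiff_iterate_Dbar {f : ℂ → ℂ} (hf : ContDiff ℝ (⊤ : ℕ∞) f) (n : ℕ) :
    ContDiff ℝ (⊤ : ℕ∞) (Dbar^[n] f) := by
  induction n with
  | zero => exact hf
  | succ n ih => rw [Function.iterate_succ_apply']; exact contDiff_Dbar ih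

lemma contDiff_conj : ContDiff ℝ (⊤ : ℕ∞) (fun z : ℂ => (starRingEnd ℂ) z) :=
  conjCLE.contDiff

lemma differentiableAt_of_smooth {f : ℂ → ℂ} (hf : ContDiff ℝ (⊤ : ℕ∞) f) (z : ℂ) :
    DifferentiableAt ℝ f z := hf.differentiable (by simp) z

lemma iterate_Dbar_mul_add_conj_mul {A B : ℂ → ℂ} (hA : ContDiff ℝ (⊤ : ℕ∞) A)
    (hB : ContDiff ℝ (⊤ : ℕ∞) B) (n : ℕ) :
    Dbar^[n + 1] (fun z => z * A z + (starRingEnd ℂ) z * B z) = fun z =>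
      z * Dbar^[n + 1] A z + ((starRingEnd ℂ) z * Dbar^[n + 1] B z
        + (n + 1) * (2 / I) * Dbar^[n] B z) := by
  have step : ∀ (c : ℂ) (A B C : ℂ → ℂ), ContDiff ℝ (⊤ : ℕ∞) A → ContDiff ℝ (⊤ : ℕ∞) B →
      ContDiff ℝ (⊤ : ℕ∞) C → ∀ z, Dbar (fun z => z * A z + ((starRingEnd ℂ) z * B z + c * C z)) z
        = z * Dbar A z + ((starRingEnd ℂ) z * Dbar B z + (2 / I) * B z + c * Dbar C z) := by
    intro c A B C hA hB hC z
    have h1 := differentiableAt_of_smooth (contDiff_id.mul hA) z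
    have h2 := differentiableAt_of_smooth (contDiff_conj.mul hB) z
    have h3 := differentiableAt_of_smooth (contDiff_const.mul hC : ContDiff ℝ _ fun z => c * C z) z
    simp only [id] at h1
    rw [Dbar_add h1 (h2.fun_add h3), Dbar_add h2 h3,
      Dbar_mul_of_differentiableAt differentiableAt_fun_id (differentiableAt_of_smooth hA z),
      Dbar_mul_of_differentiableAt (differentiableAt_const c) (differentiableAt_of_smooth hC z),
      Dbar_mul (differentiableAt_of_smooth contDiff_conj z) (differentiableAt_of_smooth hB z),
      Dbar_conj]
    ring
  induction n with
  | zero =>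
    funext z
    have := step 0 A B B hA hB hB z
    simp only [zero_mul, add_zero] at this
    simp [this]
  | succ n ih =>
    rw [Function.iterate_succ_apply', ih]
    funext z
    rw [step _ _ _ _ (contDiff_iterate_Dbar hA _) (contDiff_iterate_Dbar hB _)
      (contDiff_iterate_Dbar hB _)]
    simp only [← Function.iterate_succ_apply' Dbar]
    push_cast
    ring

lemma exists_eq_mul_add_conj_pow_mul (n : ℕ) : ∀ {f : ℂ → ℂ}, ContDiff ℝ (⊤ : ℕ∞) f →
    (∀ n, Dbar^[n] f 0 = 0) → ∃ A B : ℂ → ℂ, ContDiff ℝ (⊤ : ℕ∞) A ∧ ContDiff ℝ (⊤ : ℕ∞) B ∧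
      ∀ z, f z = z * A z + (starRingEnd ℂ) z ^ n * B z := by
  induction n with
  | zero => exact fun {f} hf _ => ⟨0, f, contDiff_const, hf, by simp⟩
  | succ n ih =>
    intro f hf h0
    obtain ⟨A, B, hA, hB, h⟩ := exists_eq_mul_add_conj_mul hf (h0 0)
    have hB0 : ∀ k, Dbar^[k] B 0 = 0 := by
      intro k
      have := h0 (k + 1)
      rw [funext h, iterate_Dbar_mul_add_conj_mul hA hB] at this
      have hk : (k : ℂ) + 1 ≠ 0 := by exact_mod_cast k.succ_ne_zero
      simpa [hk] using this
    obtain ⟨A', B', hA', hB', h'⟩ := ih hB hB0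
    refine ⟨fun z => A z + (starRingEnd ℂ) z * A' z, B', hA.add (contDiff_conj.mul hA'), hB',
      fun z => ?_⟩
    rw [h, h']
    ring

/-- A smooth function all of whose pure `∂_z̄`-derivatives vanish at `0` is divisible by `z`. -/
lemma exists_smooth_eq_mul {f : ℂ → ℂ} (hf : ContDiff ℝ (⊤ : ℕ∞) f)
    (h0 : ∀ n, Dbar^[n] f 0 = 0) :
    ∃ w : ℂ → ℂ, ContDiff ℝ (⊤ : ℕ∞) w ∧ ∀ z, f z = z * w z := by
  have hw : ∀ n : ℕ, ∃ w : ℂ → ℂ, ContDiff ℝ n w ∧ ∀ z, f z = z * w z := by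
    intro n
    obtain ⟨A, B, hA, hB, h⟩ := exists_eq_mul_add_conj_pow_mul (n + 2) hf h0
    refine ⟨fun z => A z + (starRingEnd ℂ) z ^ (n + 2) / z ^ 1 * B z,
      (hA.of_le (by exact_mod_cast le_top)).add
        ((contDiff_conj_pow_div_pow n (n + 2) 1 (by omega)).mul
          (hB.of_le (by exact_mod_cast le_top))), fun z => ?_⟩
    rw [h]
    by_cases hz : z = 0
    · subst hz; simp
    · field_simp
  obtain ⟨w, hw0, hwf⟩ := hw 0
  refine ⟨w, contDiff_infty.2 fun n => ?_, hwf⟩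
  obtain ⟨w', hw', hwf'⟩ := hw n
  have : w = w' := by
    refine Continuous.ext_on (dense_compl_singleton (0 : ℂ)) hw0.continuous hw'.continuous ?_
    intro z hz
    exact mul_left_cancel₀ hz ((hwf z).symm.trans (hwf' z))
  rwa [this]

lemma iterate_Dbar_system_eq_zero {a b f g : ℂ → ℂ}
    (ha : ContDiff ℝ (⊤ : ℕ∞) a) (hb : ContDiff ℝ (⊤ : ℕ∞) b)
    (hf : ContDiff ℝ (⊤ : ℕ∞) f) (hg : ContDiff ℝ (⊤ : ℕ∞) g)
    (hfe : ∀ z, Dbar f z = a z * g z) (hge : ∀ z, Dbar g z = b z * f z)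
    (hf0 : f 0 = 0) (hg0 : g 0 = 0) (n : ℕ) : ∀ p q : ℂ → ℂ, ContDiff ℝ (⊤ : ℕ∞) p →
      ContDiff ℝ (⊤ : ℕ∞) q → Dbar^[n] (fun z => p z * f z + q z * g z) 0 = 0 := by
  induction n with
  | zero => intro p q _ _; simp [hf0, hg0]
  | succ n ih =>
    intro p q hp hq
    have : Dbar (fun z => p z * f z + q z * g z) = fun z =>
        (Dbar p z + q z * b z) * f z + (Dbar q z + p z * a z) * g z := by
      funext z
      rw [Dbar_add (differentiableAt_of_smooth (hp.mul hf) z)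
        (differentiableAt_of_smooth (hq.mul hg) z),
        Dbar_mul (differentiableAt_of_smooth hp z) (differentiableAt_of_smooth hf z),
        Dbar_mul (differentiableAt_of_smooth hq z) (differentiableAt_of_smooth hg z), hfe, hge]
      ring
    rw [Function.iterate_succ_apply, this]
    exact ih _ _ ((contDiff_Dbar hp).add (hq.mul hb)) ((contDiff_Dbar hq).add (hp.mul ha))

/-- A solution of the first order system vanishing at `p` is divisible by `z - p`, and the
quotient solves the same system. -/
lemma exists_smooth_system_div {a b f g : ℂ → ℂ}
    (ha : ContDiff ℝ (⊤ : ℕ∞) a) (hb : ContDiff ℝ (⊤ : ℕ∞) b)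
    (hf : ContDiff ℝ (⊤ : ℕ∞) f) (hg : ContDiff ℝ (⊤ : ℕ∞) g)
    (hfe : ∀ z, Dbar f z = a z * g z) (hge : ∀ z, Dbar g z = b z * f z)
    (p : ℂ) (hf0 : f p = 0) (hg0 : g p = 0) :
    ∃ f' g' : ℂ → ℂ, ContDiff ℝ (⊤ : ℕ∞) f' ∧ ContDiff ℝ (⊤ : ℕ∞) g' ∧
      (∀ z, f z = (z - p) * f' z) ∧ (∀ z, g z = (z - p) * g' z) ∧
      (∀ z, Dbar f' z = a z * g' z) ∧ (∀ z, Dbar g' z = b z * f' z) := by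
  have tr : ∀ {h : ℂ → ℂ}, ContDiff ℝ (⊤ : ℕ∞) h → ∀ c : ℂ,
      ContDiff ℝ (⊤ : ℕ∞) (fun z => h (z + c)) := fun hh c =>
    hh.comp (contDiff_id.add contDiff_const)
  have zero := fun n => iterate_Dbar_system_eq_zero (tr ha p) (tr hb p) (tr hf p) (tr hg p)
    (fun z => by rw [Dbar_comp_add, hfe]) (fun z => by rw [Dbar_comp_add, hge])
    (by simpa using hf0) (by simpa using hg0) n
  obtain ⟨f', hf', hff'⟩ := exists_smooth_eq_mul (tr hf p) fun n => by
    simpa using zero n (fun _ => 1) (fun _ => 0) contDiff_const contDiff_const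
  obtain ⟨g', hg', hgg'⟩ := exists_smooth_eq_mul (tr hg p) fun n => by
    simpa using zero n (fun _ => 0) (fun _ => 1) contDiff_const contDiff_const
  have hF : ∀ z, f z = (z - p) * f' (z + -p) := fun z => by
    have := hff' (z - p); rwa [sub_add_cancel] at this
  have hG : ∀ z, g z = (z - p) * g' (z + -p) := fun z => by
    have := hgg' (z - p); rwa [sub_add_cancel] at this
  have eqn : ∀ {f g F G c : ℂ → ℂ}, ContDiff ℝ (⊤ : ℕ∞) F → ContDiff ℝ (⊤ : ℕ∞) G →
      ContDiff ℝ (⊤ : ℕ∞) c → (∀ z, f z = (z - p) * F z) → (∀ z, g z = (z - p) * G z) →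
      (∀ z, Dbar f z = c z * g z) → ∀ z, Dbar F z = c z * G z := by
    intro f g F G c hF hG hc hfF hgG hfe z
    refine congrFun (Continuous.ext_on (dense_compl_singleton p) (contDiff_Dbar hF).continuous
      (hc.mul hG).continuous fun z hz => ?_) z
    have h := hfe z
    rw [hgG, funext hfF, Dbar_mul_of_differentiableAt (by fun_prop)
      (differentiableAt_of_smooth hF z)] at h
    exact mul_left_cancel₀ (sub_ne_zero.2 hz) (h.trans (by ring))
  exact ⟨_, _, tr hf' (-p), tr hg' (-p), hF, hG, eqn (tr hf' _) (tr hg' _) ha hF hG hfe,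
    eqn (tr hg' _) (tr hf' _) hb hG hF hge⟩

end Dbar

/-- A function agreeing near each point, off that point, with a smooth function
extends to a smooth function. -/
lemma exists_contDiff_extension (𝕜 : Type*) {D E : Type*} [NontriviallyNormedField 𝕜]
    [NormedAddCommGroup D] [NormedSpace 𝕜 D] [Nontrivial D] [NormedAddCommGroup E]
    [NormedSpace 𝕜 E] {n : WithTop ℕ∞} (hn : 1 ≤ n) {f : D → E}
    (hf : ∀ p, ∃ w : D → E, ContDiffAt 𝕜 n w p ∧ f =ᶠ[𝓝[≠] p] w) :
    ∃ F : D → E, ContDiff 𝕜 n F ∧ ∀ p, f =ᶠ[𝓝[≠] p] F := by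
  have hne (p : D) : (𝓝[≠] p).NeBot := Module.punctured_nhds_neBot 𝕜 D p
  choose w hw hfw using hf
  have key : ∀ p, (fun z => w z z) =ᶠ[𝓝 p] w p := by
    intro p
    have hc : ∀ᶠ z in 𝓝 p, ContinuousAt (w p) z :=
      (((hw p).of_le hn).eventually (by simp)).mono fun z hz => hz.continuousAt
    have h1 : ∀ᶠ z in 𝓝[≠] p, w z z = w p z := by
      filter_upwards [eventually_eventually_nhdsWithin.2 (hfw p), self_mem_nhdsWithin,
        hc.filter_mono nhdsWithin_le_nhds] with z hz hzp hcz
      rw [IsOpen.nhdsWithin_eq isOpen_compl_singleton hzp] at hz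
      have h2 : w z =ᶠ[𝓝[≠] z] w p := (hfw z).symm.trans (hz.filter_mono nhdsWithin_le_nhds)
      exact (((hw z).continuousAt.eventuallyEq_nhds_iff_eventuallyEq_nhdsNE hcz).1 h2).self_of_nhds
    rw [eventually_nhdsWithin_iff] at h1
    filter_upwards [h1] with z hz
    by_cases h : z = p
    · rw [h]
    · exact hz h
  exact ⟨fun z => w z z, contDiff_iff_contDiffAt.2 fun p => (hw p).congr_of_eventuallyEq (key p),
    fun p => (hfw p).trans ((key p).symm.filter_mono nhdsWithin_le_nhds)⟩

section PuncturedNeighbourhood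

lemma eq_of_eventuallyEq_nhdsNE {X : Type*} [TopologicalSpace X] [T2Space X] {f g : ℂ → X}
    {p : ℂ} (hf : ContinuousAt f p) (hg : ContinuousAt g p) (h : f =ᶠ[𝓝[≠] p] g) : f p = g p :=
  ((hf.eventuallyEq_nhds_iff_eventuallyEq_nhdsNE hg).1 h).eq_of_nhds

lemma tendsto_add_nhdsNE (p a : ℂ) : Tendsto (fun z => z + a) (𝓝[≠] p) (𝓝[≠] (p + a)) :=
  tendsto_nhdsWithin_iff.2 ⟨tendsto_nhdsWithin_of_tendsto_nhds
    (Continuous.tendsto (by fun_prop) p), by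
      filter_upwards [self_mem_nhdsWithin] with z hz using by simpa using hz⟩

end PuncturedNeighbourhood

section Lattice

lemma ω_eq : ω = -1 / 2 + Real.sqrt 3 / 2 * I := by
  have : (2 * Real.pi * I / 3 : ℂ) = ((2 * Real.pi / 3 : ℝ) : ℂ) * I := by push_cast; ring
  rw [ω, this, exp_mul_I, ← ofReal_cos, ← ofReal_sin]
  have h : (2 * Real.pi / 3 : ℝ) = Real.pi - Real.pi / 3 := by ring
  rw [h, Real.cos_pi_sub, Real.sin_pi_sub, Real.cos_pi_div_three, Real.sin_pi_div_three]
  push_cast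
  ring

lemma ω_sq_add : ω ^ 2 + ω + 1 = 0 := by
  have h : ((Real.sqrt 3 : ℝ) : ℂ) ^ 2 = 3 := by
    rw [← ofReal_pow, Real.sq_sqrt (by norm_num)]; norm_num
  rw [ω_eq]
  linear_combination (1 / 4 : ℂ) * h * I ^ 2 + (3 / 4 : ℂ) * I_sq

lemma ω_pow_three : ω ^ 3 = 1 := by linear_combination (ω - 1) * ω_sq_add

lemma ω_ne_zero : ω ≠ 0 := exp_ne_zero _

lemma im_ω : ω.im = Real.sqrt 3 / 2 := by rw [ω_eq]; simp

lemma im_ω_pos : 0 < ω.im := by rw [im_ω]; positivity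

lemma ω_ne_one : ω ≠ 1 := by
  intro h
  have := im_ω_pos
  simp [h] at this

/-- The lattice `Λ` as a `PeriodPair`. -/
def periods : PeriodPair where
  ω₁ := ω
  ω₂ := 1
  indep := by
    rw [LinearIndependent.pair_iff]
    intro a b h
    have h1 := congrArg Complex.im h
    have h2 := congrArg Complex.re h
    simp [im_ω_pos.ne'] at h1
    simp [h1] at h2
    exact ⟨h1, h2⟩

lemma mem_lattice_periods {z : ℂ} : z ∈ periods.lattice ↔ z ∈ Λ := by
  rw [PeriodPair.mem_lattice]
  simp only [periods, Λ, mul_one, mem_ofPred_eq, eq_comm]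

lemma add_mem_Λ {z w : ℂ} (hz : z ∈ Λ) (hw : w ∈ Λ) : z + w ∈ Λ :=
  mem_lattice_periods.1 (add_mem (mem_lattice_periods.2 hz) (mem_lattice_periods.2 hw))

lemma neg_mem_Λ {z : ℂ} (hz : z ∈ Λ) : -z ∈ Λ :=
  mem_lattice_periods.1 (neg_mem (mem_lattice_periods.2 hz))

lemma sub_mem_Λ {z w : ℂ} (hz : z ∈ Λ) (hw : w ∈ Λ) : z - w ∈ Λ :=
  mem_lattice_periods.1 (sub_mem (mem_lattice_periods.2 hz) (mem_lattice_periods.2 hw))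

lemma ω_mul_mem_Λ {z : ℂ} (hz : z ∈ Λ) : ω * z ∈ Λ := by
  obtain ⟨m, n, rfl⟩ := hz
  refine ⟨n - m, -m, ?_⟩
  push_cast
  linear_combination (m : ℂ) * ω_sq_add

lemma ω_mul_mem_Λ_iff {z : ℂ} : ω * z ∈ Λ ↔ z ∈ Λ := by
  refine ⟨fun h => ?_, ω_mul_mem_Λ⟩
  have h2 := ω_mul_mem_Λ (ω_mul_mem_Λ h)
  have : ω * (ω * (ω * z)) = z := by linear_combination z * ω_pow_three
  rwa [this] at h2

lemma neg_mem_Λ_iff {z : ℂ} : -z ∈ Λ ↔ z ∈ Λ :=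
  ⟨fun h => by simpa using neg_mem_Λ h, neg_mem_Λ⟩

lemma exists_sub_mem_closedBall (z : ℂ) : ∃ γ ∈ Λ, z - γ ∈ Metric.closedBall (0 : ℂ) 2 := by
  have hω : ‖ω‖ = 1 := by
    have : (2 * Real.pi * I / 3 : ℂ) = ((2 * Real.pi / 3 : ℝ) : ℂ) * I := by push_cast; ring
    rw [ω, this, norm_exp_ofReal_mul_I]
  set a := z.im / ω.im
  set b := z.re - a * ω.re
  have hz : z = a * ω + b := by
    apply Complex.ext
    · simp [b]
    · simp [a, im_ω_pos.ne']
  refine ⟨⌊a⌋ * ω + ⌊b⌋, ⟨_, _, rfl⟩, ?_⟩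
  have h : z - (⌊a⌋ * ω + ⌊b⌋) = ((Int.fract a : ℝ) : ℂ) * ω + ((Int.fract b : ℝ) : ℂ) := by
    rw [← Int.self_sub_floor, ← Int.self_sub_floor]
    push_cast
    linear_combination hz
  rw [mem_closedBall_zero_iff, h]
  refine (norm_add_le _ _).trans ?_
  rw [norm_mul, hω, norm_real, norm_real, Real.norm_of_nonneg (Int.fract_nonneg _),
    Real.norm_of_nonneg (Int.fract_nonneg _)]
  linarith [(Int.fract_lt_one a).le, (Int.fract_lt_one b).le]

/-- A fixed point of `z ↦ ωz` on `ℂ/Λ` outside the lattice. -/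
def IsStacking (p : ℂ) : Prop := ω * p - p ∈ Λ ∧ p ∉ Λ

lemma IsStacking.neg {p : ℂ} (hp : IsStacking p) : IsStacking (-p) :=
  ⟨by have := neg_mem_Λ hp.1; rwa [show ω * -p - -p = -(ω * p - p) by ring],
    fun h => hp.2 (neg_mem_Λ_iff.1 h)⟩

lemma IsStacking.add {p γ : ℂ} (hp : IsStacking p) (hγ : γ ∈ Λ) : IsStacking (p + γ) :=
  ⟨by
    have := add_mem_Λ hp.1 (sub_mem_Λ (ω_mul_mem_Λ hγ) hγ)
    rwa [show ω * (p + γ) - (p + γ) = ω * p - p + (ω * γ - γ) by ring],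
    fun h => hp.2 (by simpa using sub_mem_Λ h hγ)⟩

lemma IsStacking.three_mul_mem {p : ℂ} (hp : IsStacking p) : 3 * p ∈ Λ := by
  have h := neg_mem_Λ (sub_mem_Λ (ω_mul_mem_Λ hp.1) hp.1)
  rw [← ω_mul_mem_Λ_iff]
  convert h using 1
  linear_combination p * ω_sq_add

lemma IsStacking.two_mul {p : ℂ} (hp : IsStacking p) : IsStacking (2 * p) := by
  have := hp.neg.add hp.three_mul_mem
  rwa [show -p + 3 * p = 2 * p by ring] at this

/-- The stacking point `(2 + ω)/3`. -/
def stackPt : ℂ := (2 + ω) / 3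

lemma ω_mul_stackPt : ω * stackPt = stackPt - 1 := by
  unfold stackPt
  linear_combination (1 / 3 : ℂ) * ω_sq_add

lemma isStacking_stackPt : IsStacking stackPt := by
  refine ⟨⟨0, -1, by rw [ω_mul_stackPt]; push_cast; ring⟩, ?_⟩
  rintro ⟨m, n, h⟩
  have h1 := congrArg Complex.im h
  have h3 : (ω.im : ℝ) * (3 * m - 1) = 0 := by
    simp [stackPt] at h1
    linarith
  have h4 := (mul_eq_zero.1 h3).resolve_left im_ω_pos.ne'
  have h5 : (3 * m - 1 : ℤ) = 0 := by exact_mod_cast h4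
  omega

end Lattice

section Weierstrass

lemma wp_eq : wp = periods.weierstrassP := by
  funext z
  set f : ℂ → ℂ := fun g => 1 / (z - g) ^ 2 - 1 / g ^ 2
  have hs : Summable (indicator (periods.lattice : Set ℂ) f) :=
    summable_subtype_iff_indicator.1 (periods.hasSum_weierstrassP z).summable
  have h : periods.weierstrassP z = ∑' g, indicator (periods.lattice : Set ℂ) f g :=
    tsum_subtype (periods.lattice : Set ℂ) f
  rw [h, hs.tsum_eq_add_tsum_ite 0, indicator_of_mem (zero_mem periods.lattice)]
  have h2 : ∑' γ : {g : ℂ // g ∈ Λ ∧ g ≠ 0}, f γ = ∑' g, indicator {g | g ∈ Λ ∧ g ≠ 0} f g :=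
    tsum_subtype {g | g ∈ Λ ∧ g ≠ 0} f
  have h3 : f 0 = 1 / z ^ 2 := by simp [f]
  rw [h3, wp, h2]
  congr 2
  funext g
  by_cases hg : g = 0
  · simp [hg]
  · by_cases hm : g ∈ Λ <;> simp [indicator, hg, hm, mem_lattice_periods]

lemma wp_add {γ : ℂ} (hγ : γ ∈ Λ) (z : ℂ) : wp (z + γ) = wp z := by
  rw [wp_eq]
  exact periods.weierstrassP_add_coe z ⟨γ, mem_lattice_periods.2 hγ⟩

lemma wp_ω_mul (z : ℂ) : wp (ω * z) = ω * wp z := by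
  let e : {g : ℂ // g ∈ Λ ∧ g ≠ 0} ≃ {g : ℂ // g ∈ Λ ∧ g ≠ 0} :=
    (Equiv.mulLeft₀ ω ω_ne_zero).subtypeEquiv fun g => by
      simp [ω_mul_mem_Λ_iff, ω_ne_zero]
  have hinv (x : ℂ) : 1 / (ω * x) ^ 2 = ω * (1 / x ^ 2) := by
    by_cases hx : x = 0
    · simp [hx]
    · have := ω_ne_zero
      field_simp
      linear_combination -ω_pow_three
  rw [wp, wp, mul_add, ← tsum_mul_left, hinv, ← Equiv.tsum_eq e]
  congr 2
  funext g
  change 1 / (ω * z - ω * g) ^ 2 - 1 / (ω * g) ^ 2 = _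
  rw [← mul_sub, hinv, hinv, mul_sub]

lemma IsStacking.wp_eq_zero {p : ℂ} (hp : IsStacking p) : wp p = 0 := by
  have h := wp_add hp.1 p
  rw [add_sub_cancel, wp_ω_mul] at h
  have : (ω - 1) * wp p = 0 := by rw [sub_mul, h]; ring
  exact (mul_eq_zero.1 this).resolve_left (sub_ne_zero.2 ω_ne_one)

lemma analyticAt_wp {p : ℂ} (hp : p ∉ Λ) : AnalyticAt ℂ wp p := by
  rw [wp_eq]
  exact periods.analyticOnNhd_weierstrassP p fun h => hp (mem_lattice_periods.1 h)

lemma analyticAt_wp_add {p a : ℂ} (hp : p + a ∉ Λ) : AnalyticAt ℂ (fun z => wp (z + a)) p :=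
  AnalyticAt.comp (g := wp) (f := fun z => z + a) (analyticAt_wp hp) (by fun_prop)

lemma exists_sq_mul_wp {p : ℂ} (hp : p ∈ Λ) :
    ∃ h : ℂ → ℂ, AnalyticAt ℂ h p ∧ ∀ z, z ≠ p → (z - p) ^ 2 * wp z = h z := by
  refine ⟨fun z => (z - p) ^ 2 * periods.weierstrassPExcept p z + 1 - (z - p) ^ 2 / p ^ 2,
    ?_, fun z hz => ?_⟩
  · have := periods.analyticAt_weierstrassPExcept p
    fun_prop
  · have := periods.ite_eq_one_sub_sq_mul_weierstrassP p (mem_lattice_periods.2 hp) z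
    rwa [if_neg hz, ← wp_eq] at this

lemma exists_sq_mul_wp_add {p a : ℂ} (hp : p + a ∈ Λ) :
    ∃ h : ℂ → ℂ, AnalyticAt ℂ h p ∧ ∀ z, z ≠ p → (z - p) ^ 2 * wp (z + a) = h z := by
  obtain ⟨h, hh, he⟩ := exists_sq_mul_wp hp
  refine ⟨fun z => h (z + a), AnalyticAt.comp (g := h) (f := fun z => z + a) hh (by fun_prop),
    fun z hz => ?_⟩
  beta_reduce
  rw [← he _ (by simpa using hz)]
  ring

lemma exists_wp_add_eq_sub_mul {p a : ℂ} (hp : IsStacking (p + a)) :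
    ∃ h : ℂ → ℂ, AnalyticAt ℂ h p ∧ ∀ z, wp (z + a) = (z - p) * h z := by
  have han := analyticAt_wp_add hp.2
  refine ⟨dslope (fun z => wp (z + a)) p, ?_, fun z => ?_⟩
  · obtain ⟨s, hs⟩ := han
    exact ⟨_, hs.has_fpower_series_dslope_fslope⟩
  · have := sub_smul_dslope (fun z => wp (z + a)) p z
    simpa [hp.wp_eq_zero] using this.symm

lemma eventually_wp_ne_zero (p : ℂ) : ∀ᶠ z in 𝓝[≠] p, wp z ≠ 0 := by
  have h0 : meromorphicOrderAt wp 0 ≠ ⊤ := by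
    rw [wp_eq, periods.order_weierstrassP 0 (zero_mem _)]
    decide
  have hm : Meromorphic wp := wp_eq ▸ periods.meromorphic_weierstrassP
  exact (meromorphicOrderAt_ne_top_iff_eventually_ne_zero (hm p)).1
    (hm.exists_meromorphicOrderAt_ne_top_iff_forall.1 ⟨0, h0⟩ p)

lemma eventually_wp_add_ne_zero (p a : ℂ) : ∀ᶠ z in 𝓝[≠] p, wp (z + a) ≠ 0 := by
  exact (tendsto_add_nhdsNE p a).eventually (eventually_wp_ne_zero (p + a))

/-- The product `℘(z) ℘(z + s) ℘(z - s)`, `s` the stacking point. -/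
def wpTriple (z : ℂ) : ℂ := wp (z + 0) * wp (z + stackPt) * wp (z + -stackPt)

lemma exists_analyticAt_mul_wp_wp_wp {p a b c : ℂ} (ha : p + a ∈ Λ) (hb : IsStacking (p + b))
    (hc : IsStacking (p + c)) : ∃ w : ℂ → ℂ, AnalyticAt ℂ w p ∧
      ∀ z, z ≠ p → wp (z + a) * wp (z + b) * wp (z + c) = w z := by
  obtain ⟨f, hf, hfe⟩ := exists_sq_mul_wp_add ha
  obtain ⟨g, hg, hge⟩ := exists_wp_add_eq_sub_mul hb
  obtain ⟨h, hh, hhe⟩ := exists_wp_add_eq_sub_mul hc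
  refine ⟨fun z => f z * g z * h z, by fun_prop, fun z hz => ?_⟩
  beta_reduce
  rw [hge, hhe, ← hfe z hz]
  ring

lemma exists_analyticAt_wpTriple (p : ℂ) :
    ∃ w : ℂ → ℂ, AnalyticAt ℂ w p ∧ wpTriple =ᶠ[𝓝[≠] p] w := by
  have hs := isStacking_stackPt
  have h2s := hs.two_mul
  have key {a b c : ℂ} (ha : p + a ∈ Λ) (hb : IsStacking (b - a)) (hc : IsStacking (c - a)) :
      ∃ w : ℂ → ℂ, AnalyticAt ℂ w p ∧
        ∀ z, z ≠ p → wp (z + a) * wp (z + b) * wp (z + c) = w z :=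
    exists_analyticAt_mul_wp_wp_wp ha
      (by simpa [add_comm, add_left_comm] using hb.add ha)
      (by simpa [add_comm, add_left_comm] using hc.add ha)
  have fin {w : ℂ → ℂ} (hw : ∀ z, z ≠ p → wpTriple z = w z) : wpTriple =ᶠ[𝓝[≠] p] w := by
    filter_upwards [self_mem_nhdsWithin] with z hz using hw z hz
  by_cases h0 : p + 0 ∈ Λ
  · obtain ⟨w, hw, he⟩ := key (b := stackPt) (c := -stackPt) h0
      (by simpa using hs) (by simpa using hs.neg)
    exact ⟨w, hw, fin he⟩
  by_cases h1 : p + stackPt ∈ Λ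
  · obtain ⟨w, hw, he⟩ := key (b := 0) (c := -stackPt) h1
      (by simpa using hs.neg) (by convert h2s.neg using 1; ring)
    exact ⟨w, hw, fin fun z hz => by rw [← he z hz, wpTriple]; ring⟩
  by_cases h2 : p + -stackPt ∈ Λ
  · obtain ⟨w, hw, he⟩ := key (b := 0) (c := stackPt) h2
      (by simpa using hs) (by convert h2s using 1; ring)
    exact ⟨w, hw, fin fun z hz => by rw [← he z hz, wpTriple]; ring⟩
  exact ⟨wpTriple, ((analyticAt_wp_add h0).mul (analyticAt_wp_add h1)).mul
    (analyticAt_wp_add h2), EventuallyEq.rfl⟩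

lemma exists_wpTriple_eq_const : ∃ c : ℂ, c ≠ 0 ∧ ∀ z, z ∉ Λ → z + stackPt ∉ Λ →
    z + -stackPt ∉ Λ → wpTriple z = c := by
  obtain ⟨F, hF, hFe⟩ := exists_contDiff_extension ℂ le_rfl
    (f := wpTriple) fun p => by
      obtain ⟨w, hw, he⟩ := exists_analyticAt_wpTriple p
      exact ⟨w, hw.contDiffAt, he⟩
  have hper (γ : ℂ) (hγ : γ ∈ Λ) (z : ℂ) : F (z + γ) = F z := by
    refine eq_of_eventuallyEq_nhdsNE (f := fun z => F (z + γ)) (p := z)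
      (by have := hF.continuous; fun_prop) hF.continuous.continuousAt ?_
    filter_upwards [(tendsto_add_nhdsNE z γ).eventually (hFe (z + γ)), hFe z] with w h1 h2
    rw [← h1, ← h2, wpTriple, wpTriple]
    simp only [add_right_comm w γ, wp_add hγ]
  obtain ⟨C, hC⟩ := (isCompact_closedBall (0 : ℂ) 2).exists_bound_of_continuousOn
    hF.continuous.continuousOn
  have hbdd : Bornology.IsBounded (range F) := by
    refine isBounded_iff_forall_norm_le.2 ⟨C, ?_⟩
    rintro _ ⟨z, rfl⟩
    obtain ⟨γ, hγ, h⟩ := exists_sub_mem_closedBall z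
    rw [← sub_add_cancel z γ, hper γ hγ]
    exact hC _ h
  have hconst (z : ℂ) : F z = F 0 :=
    (hF.differentiable one_ne_zero).apply_eq_apply_of_bounded hbdd z 0
  refine ⟨F 0, ?_, fun z h0 h1 h2 => ?_⟩
  · obtain ⟨z, h, h0, h1, h2⟩ := ((hFe 0).and ((eventually_wp_add_ne_zero 0 0).and
      ((eventually_wp_add_ne_zero 0 stackPt).and
        (eventually_wp_add_ne_zero 0 (-stackPt))))).exists
    rw [← hconst z, ← h]
    exact mul_ne_zero (mul_ne_zero h0 h1) h2
  · rw [← hconst z]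
    have h0 : z + 0 ∉ Λ := by simpa using h0
    exact eq_of_eventuallyEq_nhdsNE
      ((analyticAt_wp_add h0).mul (analyticAt_wp_add h1) |>.mul
        (analyticAt_wp_add h2)).continuousAt hF.continuous.continuousAt (hFe z)

end Weierstrass

section Transfer

variable {U : ℂ → ℂ} {α : ℂ}

lemma eventually_nhdsNE_nhds {P : ℂ → Prop} {p : ℂ} (h : ∀ᶠ z in 𝓝[≠] p, P z) :
    ∀ᶠ z in 𝓝[≠] p, ∀ᶠ w in 𝓝 z, P w := by
  filter_upwards [eventually_eventually_nhdsWithin.2 h, self_mem_nhdsWithin] with z hz hzp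
  rwa [isOpen_compl_singleton.nhdsWithin_eq hzp] at hz

lemma tendsto_ω_mul_nhdsNE (p : ℂ) : Tendsto (fun z => ω * z) (𝓝[≠] p) (𝓝[≠] (ω * p)) :=
  tendsto_nhdsWithin_iff.2 ⟨tendsto_nhdsWithin_of_tendsto_nhds
    (Continuous.tendsto (by fun_prop) p), by
      filter_upwards [self_mem_nhdsWithin] with z hz
      simpa [ω_ne_zero] using hz⟩

/-- A solution of the chiral equation stays one after multiplication by a meromorphic function
and removal of the singularities. -/
lemma Dbar_add_eq_zero_of_eventuallyEq_mul {V g f₁ f₂ v₁ v₂ : ℂ → ℂ} (hV : Continuous V)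
    (hf₁ : ContDiff ℝ (⊤ : ℕ∞) f₁) (hv₁ : ContDiff ℝ (⊤ : ℕ∞) v₁)
    (hv₂ : ContDiff ℝ (⊤ : ℕ∞) v₂) (heq : ∀ z, Dbar f₁ z + 0 * f₁ z + α * V z * f₂ z = 0)
    {q : ℂ} (hg : ∀ᶠ z in 𝓝[≠] q, DifferentiableAt ℂ g z)
    (h₁ : v₁ =ᶠ[𝓝[≠] q] fun z => g z * f₁ z) (h₂ : v₂ =ᶠ[𝓝[≠] q] fun z => g z * f₂ z) :
    Dbar v₁ q + 0 * v₁ q + α * V q * v₂ q = 0 := by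
  refine eq_of_eventuallyEq_nhdsNE (f := fun q => Dbar v₁ q + 0 * v₁ q + α * V q * v₂ q)
    (g := fun _ => 0) ?_ continuousAt_const ?_
  · have := (contDiff_Dbar hv₁).continuous
    have := hv₁.continuous
    have := hv₂.continuous
    fun_prop
  filter_upwards [hg, eventually_nhdsNE_nhds h₁, h₂] with z hgz h1 h2
  rw [Dbar_congr h1, Dbar_mul_of_differentiableAt hgz (differentiableAt_of_smooth hf₁ z), h2,
    EventuallyEq.eq_of_nhds h1]
  linear_combination g z * heq z

lemma exists_mem_kerPSet_smul (hU : IsTunnelling U) {p p' : ℕ} {ζ : ℂ} {g : ℂ → ℂ}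
    {u : ℂ → ℂ × ℂ} (hu : u ∈ kerPSet U (fun z => U (-z)) α p)
    (hg : ∀ q, ∀ᶠ z in 𝓝[≠] q, DifferentiableAt ℂ g z)
    (hgΛ : ∀ γ ∈ Λ, ∀ z, g (z + γ) = g z) (hgω : ∀ z, g (ω * z) = ζ * g z)
    (hζ : ζ * ω ^ (-(p : ℤ)) = ω ^ (-(p' : ℤ)))
    (hext : ∀ q, ∃ w : ℂ → ℂ × ℂ, ContDiffAt ℝ (⊤ : ℕ∞) w q ∧
      (fun z => g z • u z) =ᶠ[𝓝[≠] q] w) :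
    ∃ v ∈ kerPSet U (fun z => U (-z)) α p', ∀ q, (fun z => g z • u z) =ᶠ[𝓝[≠] q] v := by
  obtain ⟨⟨hu0, hu1, hu2, hu3, hu4⟩, hu5⟩ := hu
  obtain ⟨v, hv, hve⟩ := exists_contDiff_extension ℝ (by norm_cast) hext
  have hUc := hU.1.continuous
  have hvc := hv.continuous
  have h1 (q : ℂ) : (fun z => (v z).1) =ᶠ[𝓝[≠] q] fun z => g z * (u z).1 := by
    filter_upwards [hve q] with z hz
    rw [← hz]; rfl
  have h2 (q : ℂ) : (fun z => (v z).2) =ᶠ[𝓝[≠] q] fun z => g z * (u z).2 := by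
    filter_upwards [hve q] with z hz
    rw [← hz]; rfl
  refine ⟨v, ⟨⟨hv, fun z => ?_, fun z => ?_, fun γ hγ z => ?_, fun γ hγ z => ?_⟩, fun z => ?_⟩,
    hve⟩
  · exact Dbar_add_eq_zero_of_eventuallyEq_mul hUc hu0.fst hv.fst hv.snd hu1 (hg z) (h1 z) (h2 z)
  · exact Dbar_add_eq_zero_of_eventuallyEq_mul (V := fun z => U (-z)) (by fun_prop) hu0.snd
      hv.snd hv.fst hu2 (hg z) (h2 z) (h1 z)
  · refine eq_of_eventuallyEq_nhdsNE (f := fun z => (v (z + γ)).1)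
      (g := fun z => exp (-I * (pair γ K : ℂ)) * (v z).1) (p := z)
      (by fun_prop) (by fun_prop) ?_
    filter_upwards [(tendsto_add_nhdsNE z γ).eventually (h1 (z + γ)), h1 z] with w e1 e2
    rw [e1, e2, hgΛ γ hγ, hu3 γ hγ]
    ring
  · refine eq_of_eventuallyEq_nhdsNE (f := fun z => (v (z + γ)).2)
      (g := fun z => exp (I * (pair γ K : ℂ)) * (v z).2) (p := z)
      (by fun_prop) (by fun_prop) ?_
    filter_upwards [(tendsto_add_nhdsNE z γ).eventually (h2 (z + γ)), h2 z] with w e1 e2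
    rw [e1, e2, hgΛ γ hγ, hu4 γ hγ]
    ring
  · refine eq_of_eventuallyEq_nhdsNE (f := fun z => v (ω * z))
      (g := fun z => (ω ^ (-(p' : ℤ))) • v z) (p := z) (by fun_prop)
      (Continuous.continuousAt (by fun_prop)) ?_
    filter_upwards [(tendsto_ω_mul_nhdsNE z).eventually (hve (ω * z)), hve z] with w e1 e2
    rw [← e1, ← e2, hgω, hu5, smul_smul, smul_smul, ← hζ]
    congr 1
    ring

end Transfer

section Kernel

variable {U : ℂ → ℂ} {α : ℂ} {u : ℂ → ℂ × ℂ}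

/-- `u` is a smooth solution of `D(α)u = 0`, without boundary conditions. -/
def IsSolution (U : ℂ → ℂ) (α : ℂ) (u : ℂ → ℂ × ℂ) : Prop :=
  ContDiff ℝ (⊤ : ℕ∞) u ∧ (∀ z, Dbar (fun z => (u z).1) z = -α * U z * (u z).2) ∧
    ∀ z, Dbar (fun z => (u z).2) z = -α * U (-z) * (u z).1

lemma isSolution_of_mem_kerSet (hu : u ∈ kerSet U (fun z => U (-z)) α 0) :
    IsSolution U α u :=
  ⟨hu.1, fun z => by linear_combination hu.2.1 z, fun z => by linear_combination hu.2.2.1 z⟩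

lemma IsSolution.exists_eq_sub_smul (hU : IsTunnelling U) (hu : IsSolution U α u) {p : ℂ}
    (hp : u p = 0) : ∃ w : ℂ → ℂ × ℂ, IsSolution U α w ∧ ∀ z, u z = (z - p) • w z := by
  obtain ⟨hu0, hu1, hu2⟩ := hu
  have hUs := hU.1
  obtain ⟨f, g, hf, hg, hfe, hge, hfD, hgD⟩ := exists_smooth_system_div
    (a := fun z => -α * U z) (b := fun z => -α * U (-z)) (f := fun z => (u z).1)
    (g := fun z => (u z).2) (by fun_prop) (by fun_prop) hu0.fst hu0.snd hu1 hu2 p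
    (by simp [hp]) (by simp [hp])
  exact ⟨fun z => (f z, g z), ⟨hf.prodMk hg, hfD, hgD⟩, fun z => Prod.ext (hfe z) (hge z)⟩

lemma eq_zero_of_smul_ω_mul {w : ℂ → ℂ × ℂ} (hw : Continuous w) {c : ℂ} (hc : c ≠ ω)
    (h : ∀ z, (ω * z) • w (ω * z) = c • z • w z) : w 0 = 0 := by
  have h0 : ω • w (ω * 0) = c • w 0 := by
    refine eq_of_eventuallyEq_nhdsNE (f := fun z => ω • w (ω * z)) (g := fun z => c • w z)
      (Continuous.continuousAt (by fun_prop)) (Continuous.continuousAt (by fun_prop)) ?_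
    filter_upwards [self_mem_nhdsWithin] with z hz
    refine smul_right_injective _ (show z ≠ 0 from hz) ?_
    have := h z
    simp only [smul_smul] at this ⊢
    rw [mul_comm z, this, mul_comm z]
  rw [mul_zero, ← sub_eq_zero, ← sub_smul, smul_eq_zero] at h0
  exact h0.resolve_left (sub_ne_zero.2 hc.symm)

lemma ω_sq_ne_one : ω ^ 2 ≠ 1 := fun h => ω_ne_one <| by
  linear_combination ω_pow_three - ω * h

lemma ω_zpow_neg_one : ω ^ (-1 : ℤ) = ω ^ 2 := by
  rw [zpow_neg_one]
  exact inv_eq_of_mul_eq_one_right (by linear_combination ω_pow_three)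

lemma exists_eq_sq_smul (hU : IsTunnelling U) (hu : u ∈ kerPSet U (fun z => U (-z)) α 1) :
    ∃ w : ℂ → ℂ × ℂ, ContDiff ℝ (⊤ : ℕ∞) w ∧ ∀ z, u z = z ^ 2 • w z := by
  obtain ⟨hk, hr⟩ := hu
  simp only [Nat.cast_one, ω_zpow_neg_one] at hr
  have h0 : u 0 = 0 := by
    have h := hr 0
    rw [mul_zero, eq_comm, ← sub_eq_zero] at h
    nth_rewrite 2 [← one_smul ℂ (u 0)] at h
    rw [← sub_smul, smul_eq_zero] at h
    exact h.resolve_left (sub_ne_zero.2 ω_sq_ne_one)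
  obtain ⟨w, hw, hwe⟩ := (isSolution_of_mem_kerSet hk).exists_eq_sub_smul hU h0
  simp only [sub_zero] at hwe
  have hw0 : w 0 = 0 := eq_zero_of_smul_ω_mul hw.1.continuous (c := ω ^ 2)
    (fun h => ω_sq_ne_one (by linear_combination ω_pow_three - ω * h))
    fun z => by rw [← hwe, ← hwe, hr]
  obtain ⟨w', hw', hwe'⟩ := hw.exists_eq_sub_smul hU hw0
  exact ⟨w', hw'.1, fun z => by rw [hwe, hwe', smul_smul, sub_zero, sq]⟩

lemma eq_phase_mul (hu : u ∈ kerSet U (fun z => U (-z)) α 0) {γ : ℂ} (hγ : γ ∈ Λ) (z : ℂ) :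
    u z = (exp (-I * (pair γ K : ℂ)) * (u (z - γ)).1,
      exp (I * (pair γ K : ℂ)) * (u (z - γ)).2) := by
  obtain ⟨-, -, -, h1, h2⟩ := hu
  refine Prod.ext ?_ ?_
  · simpa using h1 γ hγ (z - γ)
  · simpa using h2 γ hγ (z - γ)

lemma exp_pair_one : exp (I * (pair 1 K : ℂ)) = ω ^ 2 := by
  have h : pair 1 K = 4 * Real.pi / 3 := by
    have : K = ((4 * Real.pi / 3 : ℝ) : ℂ) := by rw [K]; push_cast; rfl
    rw [pair, this, conj_ofReal, one_mul, ofReal_re]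
  rw [ω, ← exp_nat_mul, h]
  congr 1
  push_cast
  ring

lemma eq_zero_of_ω_mul (hu : u ∈ kerPSet U (fun z => U (-z)) α 0) {q : ℂ}
    (hq : ω * q = q - 1 ∨ ω * q = q + 1) : u q = 0 := by
  obtain ⟨⟨-, -, -, h1, h2⟩, hr⟩ := hu
  have hq' : u (ω * q) = u q := by simpa using hr q
  have h1Λ : (1 : ℂ) ∈ Λ := ⟨0, 1, by simp⟩
  have hper (x : ℂ) (hx : u (x + 1) = u x) : u x = 0 := by
    have hexp : ω ^ 2 * exp (-I * (pair 1 K : ℂ)) = 1 := by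
      rw [← exp_pair_one, ← exp_add, neg_mul, add_neg_cancel, exp_zero]
    have e1 := h1 1 h1Λ x
    have e2 := h2 1 h1Λ x
    rw [hx] at e1 e2
    rw [exp_pair_one] at e2
    have h3 : ω ^ 2 - 1 ≠ 0 := sub_ne_zero.2 ω_sq_ne_one
    refine Prod.ext ((mul_eq_zero.1 ?_).resolve_left h3) ((mul_eq_zero.1 ?_).resolve_left h3)
    · linear_combination ω ^ 2 * e1 + (u x).1 * hexp
    · linear_combination -e2
  rcases hq with h | h
  · rw [h] at hq'
    rw [← hq', hper (q - 1) (by rw [sub_add_cancel, hq'])]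
  · exact hper q (by rw [← h, hq'])

lemma eq_zero_of_sub_mem (hu : u ∈ kerSet U (fun z => U (-z)) α 0) {p q : ℂ}
    (hpq : p - q ∈ Λ) (hq : u q = 0) : u p = 0 := by
  rw [eq_phase_mul hu hpq p, sub_sub_cancel, hq]
  simp

end Kernel

section Multipliers

variable {U : ℂ → ℂ} {α : ℂ} {u v : ℂ → ℂ × ℂ}

lemma contDiffAt_smul_of_analyticAt {h : ℂ → ℂ} {p : ℂ} (hh : AnalyticAt ℂ h p)
    (hu : ContDiff ℝ (⊤ : ℕ∞) u) : ContDiffAt ℝ (⊤ : ℕ∞) (fun z => h z • u z) p :=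
  (hh.contDiffAt.restrict_scalars ℝ).smul hu.contDiffAt

lemma wp_eq_zero_of_mem {γ : ℂ} (hγ : γ ∈ Λ) : wp γ = 0 := by
  rw [wp_eq]
  exact periods.weierstrassP_coe ⟨γ, mem_lattice_periods.2 hγ⟩

lemma eventually_add_notMem_Λ (p a : ℂ) : ∀ᶠ z in 𝓝[≠] p, z + a ∉ Λ := by
  filter_upwards [eventually_wp_add_ne_zero p a] with z hz h using hz (wp_eq_zero_of_mem h)

lemma exists_mem_kerPSet_zero (hU : IsTunnelling U) (hu : u ∈ kerPSet U (fun z => U (-z)) α 1) :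
    ∃ v ∈ kerPSet U (fun z => U (-z)) α 0, ∀ q, (fun z => wp z • u z) =ᶠ[𝓝[≠] q] v := by
  refine exists_mem_kerPSet_smul hU hu (ζ := ω) (fun q => ?_) (fun γ hγ => wp_add hγ)
    wp_ω_mul (by rw [Nat.cast_one, zpow_neg_one, mul_inv_cancel₀ ω_ne_zero]; simp) fun q => ?_
  · filter_upwards [eventually_add_notMem_Λ q 0] with z hz
    exact (analyticAt_wp (by simpa using hz)).differentiableAt
  by_cases hq : q ∈ Λ
  · obtain ⟨w, hw, hwe⟩ := exists_eq_sq_smul hU hu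
    obtain ⟨h, hh, he⟩ := exists_sq_mul_wp hq
    refine ⟨fun z => h z • (exp (-I * (pair q K : ℂ)) * (w (z - q)).1,
      exp (I * (pair q K : ℂ)) * (w (z - q)).2),
      contDiffAt_smul_of_analyticAt hh (by fun_prop), ?_⟩
    filter_upwards [self_mem_nhdsWithin] with z hz
    rw [eq_phase_mul hu.1 hq z, ← he z hz, hwe]
    refine Prod.ext ?_ ?_ <;> simp only [Prod.smul_mk, Prod.smul_fst, Prod.smul_snd, smul_eq_mul]
      <;> ring
  · exact ⟨_, contDiffAt_smul_of_analyticAt (analyticAt_wp hq) hu.1.1, EventuallyEq.rfl⟩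

lemma exists_contDiffAt_eq_wp_mul_wp_smul (hU : IsTunnelling U) (hu : IsSolution U α u)
    {p a b : ℂ} (ha : p + a ∈ Λ) (hb : IsStacking (b - a)) (hp : u p = 0) :
    ∃ w : ℂ → ℂ × ℂ, ContDiffAt ℝ (⊤ : ℕ∞) w p ∧
      ∀ z, z ≠ p → (wp (z + a) * wp (z + b)) • u z = w z := by
  obtain ⟨w, hw, hwe⟩ := hu.exists_eq_sub_smul hU hp
  obtain ⟨f, hf, hfe⟩ := exists_sq_mul_wp_add ha
  obtain ⟨g, hg, hge⟩ := exists_wp_add_eq_sub_mul (p := p) (a := b)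
    (by simpa [add_comm, add_left_comm] using hb.add ha)
  refine ⟨_, contDiffAt_smul_of_analyticAt (hf.mul hg) hw.1, fun z hz => ?_⟩
  rw [hwe, hge, smul_smul]
  congr 1
  rw [Pi.mul_apply, ← hfe z hz]
  ring

lemma wp_ω_mul_add (a γ z : ℂ) (hγ : γ ∈ Λ) (ha : ω * a = a + γ) :
    wp (ω * z + a) = ω * wp (z + a) := by
  rw [← wp_ω_mul, mul_add, ha, ← add_assoc, wp_add hγ]

lemma exists_mem_kerPSet_one (hU : IsTunnelling U) {c : ℂ}
    (hv : v ∈ kerPSet U (fun z => U (-z)) α 0) :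
    ∃ u ∈ kerPSet U (fun z => U (-z)) α 1,
      ∀ q, (fun z => (c * (wp (z + stackPt) * wp (z + -stackPt))) • v z) =ᶠ[𝓝[≠] q] u := by
  have h2s := isStacking_stackPt.two_mul
  have hsol := isSolution_of_mem_kerSet hv.1
  refine exists_mem_kerPSet_smul hU hv (ζ := ω ^ 2)
    (g := fun z => c * (wp (z + stackPt) * wp (z + -stackPt))) (fun q => ?_) (fun γ hγ z => ?_)
    (fun z => ?_) (by rw [Nat.cast_one, ω_zpow_neg_one]; simp) fun q => ?_
  · filter_upwards [eventually_add_notMem_Λ q stackPt, eventually_add_notMem_Λ q (-stackPt)]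
      with z h1 h2
    exact (((analyticAt_wp_add h1).mul (analyticAt_wp_add h2)).differentiableAt).const_mul c
  · simp only [add_right_comm z γ, wp_add hγ]
  · rw [wp_ω_mul_add stackPt (-1) z ⟨0, -1, by simp⟩ (by rw [ω_mul_stackPt]; ring),
      wp_ω_mul_add (-stackPt) 1 z ⟨0, 1, by simp⟩ (by rw [mul_neg, ω_mul_stackPt]; ring)]
    ring
  suffices h : ∃ w : ℂ → ℂ × ℂ, ContDiffAt ℝ (⊤ : ℕ∞) w q ∧
      ∀ z, z ≠ q → (wp (z + stackPt) * wp (z + -stackPt)) • v z = w z by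
    obtain ⟨w, hw, he⟩ := h
    refine ⟨fun z => c • w z, hw.const_smul c, ?_⟩
    filter_upwards [self_mem_nhdsWithin] with z hz
    rw [mul_smul, he z hz]
  by_cases h1 : q + stackPt ∈ Λ
  · exact exists_contDiffAt_eq_wp_mul_wp_smul hU hsol h1
      (by convert h2s.neg using 1; ring)
      (eq_zero_of_sub_mem hv.1 (q := -stackPt) (by simpa using h1)
        (eq_zero_of_ω_mul hv (Or.inr (by rw [mul_neg, ω_mul_stackPt]; ring))))
  by_cases h2 : q + -stackPt ∈ Λ
  · obtain ⟨w, hw, he⟩ := exists_contDiffAt_eq_wp_mul_wp_smul hU hsol (b := stackPt) h2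
      (by convert h2s using 1; ring)
      (eq_zero_of_sub_mem hv.1 h2 (eq_zero_of_ω_mul hv (Or.inl ω_mul_stackPt)))
    exact ⟨w, hw, fun z hz => by rw [← he z hz, mul_comm]⟩
  exact ⟨_, contDiffAt_smul_of_analyticAt ((analyticAt_wp_add h1).mul (analyticAt_wp_add h2))
    hv.1.1, fun z _ => rfl⟩

end Multipliers

/-- **Weierstrass intertwining of representations.**
Assuming `dim Ker_p(α) ≤ 1` for all `p ∈ {0,1,2}`, multiplication by `℘` maps `Ker₁(α)`
bijectively onto `Ker₀(α)`: every `u ∈ Ker₁(α)` has a smooth extension of `℘·u` lying in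
`Ker₀(α)`, and every element of `Ker₀(α)` arises this way. -/
theorem weierstrass_intertwining (U : ℂ → ℂ) (hU : IsTunnelling U) (α : ℂ)
    (hdim : ∀ p : ℕ, p < 3 → kerPDim U (fun z => U (-z)) α p ≤ 1) :
    (∀ u ∈ kerPSet U (fun z => U (-z)) α 1,
      ∃ v ∈ kerPSet U (fun z => U (-z)) α 0, ∀ z : ℂ, z ∉ Λ → v z = wp z • u z) ∧
    (∀ v ∈ kerPSet U (fun z => U (-z)) α 0,
      ∃ u ∈ kerPSet U (fun z => U (-z)) α 1, ∀ z : ℂ, z ∉ Λ → v z = wp z • u z) := by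
  constructor
  · intro u hu
    obtain ⟨v, hv, hve⟩ := exists_mem_kerPSet_zero hU hu
    refine ⟨v, hv, fun z hz => (eq_of_eventuallyEq_nhdsNE ?_ hv.1.1.continuous.continuousAt
      (hve z)).symm⟩
    exact (contDiffAt_smul_of_analyticAt (analyticAt_wp hz) hu.1.1).continuousAt
  · intro v hv
    obtain ⟨c, hc, hce⟩ := exists_wpTriple_eq_const
    obtain ⟨u, hu, hue⟩ := exists_mem_kerPSet_one hU (c := c⁻¹) hv
    refine ⟨u, hu, fun z hz => eq_of_eventuallyEq_nhdsNE (g := fun z => wp z • u z)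
      hv.1.1.continuous.continuousAt
      (contDiffAt_smul_of_analyticAt (analyticAt_wp hz) hu.1.1).continuousAt ?_⟩
    filter_upwards [hue z, eventually_add_notMem_Λ z 0, eventually_add_notMem_Λ z stackPt,
      eventually_add_notMem_Λ z (-stackPt)] with x hx h0 h1 h2
    have h := hce x (by simpa using h0) h1 h2
    rw [wpTriple, add_zero] at h
    rw [← hx, smul_smul, show wp x * (c⁻¹ * (wp (x + stackPt) * wp (x + -stackPt))) = 1 by
      rw [← mul_inv_cancel₀ hc]; linear_combination c⁻¹ * h, one_smul]

end TBG
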